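/- arXiv:1505.03259 — 2 statements merged into one kernel-verified Lean document; each statement's English description precedes it below -/
import Mathlib

section
/- Let A ∈ ℝ^{n×n}, B ∈ ℝ^{n×m}, K ∈ ℝ^{m×n}, let 𝓛 ∈ ℝ^{N×N} and let π ∈ ℝ^N satisfy π^T 𝓛 = 0 and 𝟏^T π ≠ 0, where 𝟏 ∈ ℝ^N is the all-ones vector. Suppose the sequences X, X̂ : ℕ → ℝ^{nN} satisfy X(t+1) = (I_N ⊗ A) X(t) − (𝓛 ⊗ B K) X̂(t) for all t ≥ 0. Define X̄(t) = ((1/(𝟏^T π)) 𝟏 π^T ⊗ I_n) X(t). Then X̄(t+1) = (I_N ⊗ A) X̄(t) for all t ≥ 0. -/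
open Matrix Kronecker

/-- If `πᵀ𝓛 = 0`, `𝟏ᵀπ ≠ 0`, and `X(t+1) = (I_N ⊗ A) X(t) − (𝓛 ⊗ BK) X̂(t)`, then the weighted
average `X̄(t) = ((1/(𝟏ᵀπ)) 𝟏 πᵀ ⊗ I_n) X(t)` evolves as `X̄(t+1) = (I_N ⊗ A) X̄(t)`. -/
theorem stmt13 (n m N : ℕ)
    (A : Matrix (Fin n) (Fin n) ℝ) (B : Matrix (Fin n) (Fin m) ℝ)
    (K : Matrix (Fin m) (Fin n) ℝ) (Lap : Matrix (Fin N) (Fin N) ℝ) (π : Fin N → ℝ)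
    (hπL : Matrix.vecMul π Lap = 0) (hπ1 : (∑ k, π k) ≠ 0)
    (X Xh : ℕ → Fin N × Fin n → ℝ)
    (hX : ∀ t : ℕ, X (t + 1) =
      ((1 : Matrix (Fin N) (Fin N) ℝ) ⊗ₖ A).mulVec (X t) -
        (Lap ⊗ₖ (B * K)).mulVec (Xh t)) :
    ∀ t : ℕ,
      ((((∑ k, π k)⁻¹ • (Matrix.of fun _ j : Fin N => π j)) ⊗ₖ
          (1 : Matrix (Fin n) (Fin n) ℝ)).mulVec (X (t + 1))) =
        ((1 : Matrix (Fin N) (Fin N) ℝ) ⊗ₖ A).mulVec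
          ((((∑ k, π k)⁻¹ • (Matrix.of fun _ j : Fin N => π j)) ⊗ₖ
            (1 : Matrix (Fin n) (Fin n) ℝ)).mulVec (X t)) := by
  intro t
  have hzero : ((∑ k, π k)⁻¹ • (Matrix.of fun _ j : Fin N => π j)) * Lap = 0 := by
    rw [Matrix.smul_mul]
    have hmul : (Matrix.of fun _ j : Fin N => π j) * Lap = 0 := by
      ext i j
      exact congrFun hπL j
    rw [hmul, smul_zero]
  rw [hX, Matrix.mulVec_sub, Matrix.mulVec_mulVec, Matrix.mulVec_mulVec, Matrix.mulVec_mulVec,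
    ← Matrix.mul_kronecker_mul, ← Matrix.mul_kronecker_mul, ← Matrix.mul_kronecker_mul, hzero,
    Matrix.zero_kronecker, Matrix.zero_mulVec, sub_zero, Matrix.mul_one, Matrix.one_mul,
    Matrix.one_mul, Matrix.mul_one]
end

section
/- Let A ∈ ℝ^{n×n}, B ∈ ℝ^{n×m}, K ∈ ℝ^{m×n}, let 𝓛 ∈ ℝ^{N×N} and π ∈ ℝ^N satisfy π^T 𝓛 = 0 and Σ_{k=1}^N π_k ≠ 0. Suppose X, X̂ : ℕ → ℝ^{nN} satisfy X(t+1) = (I_N ⊗ A) X(t) − (𝓛 ⊗ B K) X̂(t) for all t ≥ 0, write X(t) = (x_1(t)^T,…,x_N(t)^T)^T with x_i(t) ∈ ℝ^n, define X̄(t) = ((1/(𝟏^T π)) 𝟏 π^T ⊗ I_n) X(t) and δ(t) = X(t) − X̄(t), and assume lim_{t→∞} δ(t) = 0. Then for every i = 1,…,N, lim_{t→∞} [ x_i(t) − A^t ( Σ_{k=1}^N π_k x_k(0) / Σ_{k=1}^N π_k ) ] = 0. -/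
open Matrix Kronecker Filter Topology

namespace Matrix

variable {ι κ μ : Type*} [Fintype ι] [Fintype κ] {R : Type*} [CommSemiring R]

theorem kronecker_mulVec_slice (L : Matrix ι ι R) (M : Matrix μ κ R) (v : ι × κ → R) (i : ι) :
    (fun k => ((L ⊗ₖ M) *ᵥ v) (i, k)) = ∑ j, L i j • M *ᵥ fun l => v (j, l) := by
  ext k
  simp only [mulVec, dotProduct, kroneckerMap_apply, Fintype.sum_prod_type, Finset.sum_apply,
    Pi.smul_apply, smul_eq_mul, Finset.mul_sum, mul_assoc]

theorem sum_smul_kronecker_mulVec_slice (w : ι → R) (L : Matrix ι ι R) (M : Matrix μ κ R)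
    (v : ι × κ → R) :
    ∑ i, w i • (fun k => ((L ⊗ₖ M) *ᵥ v) (i, k)) =
      ∑ j, (w ᵥ* L) j • M *ᵥ fun l => v (j, l) := by
  simp only [kronecker_mulVec_slice, Finset.smul_sum, smul_smul]
  rw [Finset.sum_comm]
  simp only [← Finset.sum_smul, vecMul, dotProduct]

end Matrix

/-- **Remark 4**. If `πᵀ𝓛 = 0`, `Σ_k π_k ≠ 0`, `X(t+1) = (I_N ⊗ A) X(t) − (𝓛 ⊗ BK) X̂(t)` and
the cooperative stabilization error `δ(t) = X(t) − X̄(t)` vanishes as `t → ∞`, then every agent's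
state `x_i(t)` approaches `A^t (Σ_k π_k x_k(0) / Σ_k π_k)`. -/
theorem stmt16 (n m N : ℕ)
    (A : Matrix (Fin n) (Fin n) ℝ) (B : Matrix (Fin n) (Fin m) ℝ)
    (K : Matrix (Fin m) (Fin n) ℝ) (Lap : Matrix (Fin N) (Fin N) ℝ) (π : Fin N → ℝ)
    (hπL : Matrix.vecMul π Lap = 0) (hπ1 : (∑ k, π k) ≠ 0)
    (X Xh : ℕ → Fin N × Fin n → ℝ)
    (hX : ∀ t : ℕ, X (t + 1) =
      ((1 : Matrix (Fin N) (Fin N) ℝ) ⊗ₖ A).mulVec (X t) -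
        (Lap ⊗ₖ (B * K)).mulVec (Xh t))
    (δ : ℕ → Fin N × Fin n → ℝ)
    (hδ : ∀ t, δ t = X t -
      ((((∑ k, π k)⁻¹ • (Matrix.of fun _ j : Fin N => π j)) ⊗ₖ
        (1 : Matrix (Fin n) (Fin n) ℝ)).mulVec (X t)))
    (hδ0 : Tendsto δ atTop (nhds 0)) :
    ∀ i : Fin N,
      Tendsto (fun t => (fun k => X t (i, k)) -
          (A ^ t).mulVec ((∑ j, π j)⁻¹ • ∑ j, π j • (fun k => X 0 (j, k))))
        atTop (nhds 0) := by
  have weighted_sum_eq (t : ℕ) : ∑ j, π j • (fun k => X t (j, k)) =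
      (A ^ t) *ᵥ ∑ j, π j • (fun k => X 0 (j, k)) := by
    induction t with
    | zero => simp
    | succ t ih =>
      have slice_sub (j : Fin N) : (fun k => X (t + 1) (j, k)) =
          (fun k => (((1 : Matrix (Fin N) (Fin N) ℝ) ⊗ₖ A) *ᵥ X t) (j, k)) -
            fun k => ((Lap ⊗ₖ (B * K)) *ᵥ Xh t) (j, k) := by
        ext k
        simp [hX t]
      simp only [slice_sub, smul_sub, Finset.sum_sub_distrib, sum_smul_kronecker_mulVec_slice,
        hπL, vecMul_one, Pi.zero_apply, zero_smul, Finset.sum_const_zero, sub_zero]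
      rw [pow_succ', ← mulVec_mulVec, ← ih, mulVec_sum]
      simp only [mulVec_smul]
  intro i
  have hδi : Tendsto (fun t => fun k => δ t (i, k)) atTop (nhds 0) :=
    tendsto_pi_nhds.2 fun k => tendsto_pi_nhds.1 hδ0 (i, k)
  refine hδi.congr fun t => ?_
  have average_eq := kronecker_mulVec_slice
    ((∑ k, π k)⁻¹ • (Matrix.of fun _ j : Fin N => π j)) (1 : Matrix (Fin n) (Fin n) ℝ) (X t) i
  simp only [Matrix.smul_apply, of_apply, smul_eq_mul, one_mulVec, mul_smul, ← Finset.smul_sum,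
    weighted_sum_eq t] at average_eq
  rw [mulVec_smul, ← average_eq]
  ext k
  simp [hδ t]
end
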